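/- Let F be a field, m ≥ 2, and x, y ∈ M_{2m}(F); put a = x + σ(x) and b = y + σ(y). Then Srp(a+b) − Srp(a) − Srp(b) = trace(x)·trace(y) − trace(a·y). (Split-matrix case of the polar identity for the quadratic map Srp of Lemma 1.) -/

import Mathlib

open Polynomial Matrix

/-- The standard symplectic matrix: block diagonal with `m` copies of `[[0,1],[-1,0]]`. -/
def sympJ (F : Type*) [Field F] (m : ℕ) : Matrix (Fin (2 * m)) (Fin (2 * m)) F :=
  Matrix.of fun i j =>
    if i.val % 2 = 0 ∧ j.val = i.val + 1 then (1 : F)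
    else if i.val % 2 = 1 ∧ i.val = j.val + 1 then (-1 : F)
    else 0

/-- The standard symplectic involution `σ(x) = J⁻¹ * xᵀ * J` on `M_{2m}(F)`. -/
noncomputable def sympInv (F : Type*) [Field F] (m : ℕ)
    (x : Matrix (Fin (2 * m)) (Fin (2 * m)) F) : Matrix (Fin (2 * m)) (Fin (2 * m)) F :=
  (sympJ F m)⁻¹ * xᵀ * sympJ F m

/-- A skew-symmetric matrix over a field of characteristic not two has square determinant. -/
theorem isSquare_det_of_transpose_eq_neg {K : Type*} [Field K] (h2 : (2 : K) ≠ 0) {n : Type*}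
    [Fintype n] [DecidableEq n] (A : Matrix n n K) (hA : Aᵀ = -A) : IsSquare A.det := by
  induction hN : Fintype.card n using Nat.strong_induction_on generalizing n with
  | _ N ih =>
  have hskew (i j : n) : A j i = -A i j := congrFun (congrFun hA i) j
  have hdiag (i : n) : A i i = 0 := by
    have h := hskew i i
    have : 2 * A i i = 0 := by linear_combination h
    exact (mul_eq_zero.mp this).resolve_left h2
  by_cases h0 : A = 0
  · subst h0
    cases isEmpty_or_nonempty n <;> simp
  obtain ⟨i, j, hij⟩ : ∃ i j, A i j ≠ 0 := by
    by_contra! h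
    exact h0 (Matrix.ext h)
  have hne : i ≠ j := fun h ↦ hij (h ▸ hdiag i)
  let p : n → Prop := fun k ↦ k = i ∨ k = j
  have hcard : Fintype.card {k // ¬ p k} < N := hN ▸ Fintype.card_subtype_lt (x := i) (by simp [p])
  let e : Fin 2 ≃ {k // p k} := Equiv.ofBijective ![⟨i, Or.inl rfl⟩, ⟨j, Or.inr rfl⟩] (by
    constructor
    · intro a b h
      fin_cases a <;> fin_cases b <;> simp [hne, hne.symm] at h ⊢
    · rintro ⟨k, rfl | rfl⟩
      · exact ⟨0, rfl⟩
      · exact ⟨1, rfl⟩)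
  have hB : (A.toBlock p p).det = A i j * A i j := by
    rw [← det_submatrix_equiv_self e, det_fin_two]
    have he0 : (e 0 : n) = i := rfl
    have he1 : (e 1 : n) = j := rfl
    simp only [submatrix_apply, toBlock_apply, he0, he1, hdiag, hskew i j]
    ring
  have hBt : (A.toBlock p p)ᵀ = -A.toBlock p p := by
    ext a b; exact hskew _ _
  have hCt : (A.toBlock (fun k ↦ ¬ p k) p)ᵀ = -A.toBlock p fun k ↦ ¬ p k := by
    ext a b; exact hskew _ _
  have hCt' : (A.toBlock p fun k ↦ ¬ p k)ᵀ = -A.toBlock (fun k ↦ ¬ p k) p := by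
    ext a b; exact hskew _ _
  have hDt : (A.toBlock (fun k ↦ ¬ p k) fun k ↦ ¬ p k)ᵀ =
      -A.toBlock (fun k ↦ ¬ p k) fun k ↦ ¬ p k := by
    ext a b; exact hskew _ _
  have hunit : IsUnit (A.toBlock p p).det := by
    rw [hB]; exact (mul_ne_zero hij hij).isUnit
  let := invertibleOfIsUnitDet _ hunit
  rw [det_toBlock A p, det_fromBlocks₁₁, hB]
  refine IsSquare.mul ⟨_, rfl⟩ (ih _ hcard _ ?_ rfl)
  have hinv : ((A.toBlock p p)⁻¹)ᵀ = -(A.toBlock p p)⁻¹ := by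
    rw [transpose_nonsing_inv, hBt]
    refine inv_eq_right_inv ?_
    simp [mul_nonsing_inv _ hunit]
  rw [invOf_eq_nonsing_inv, transpose_sub, transpose_mul, transpose_mul, hDt, hCt, hCt', hinv]
  simp [Matrix.mul_assoc]
  abel

/-- The second coefficient of `det (1 - X a)` is determined by `tr a` and `tr (a ^ 2)`. -/
theorem two_mul_coeff_two_charpolyRev {R : Type*} [CommRing R] {n : Type*} [Fintype n]
    [DecidableEq n] (a : Matrix n n R) :
    2 * a.charpolyRev.coeff 2 = a.trace ^ 2 - (a * a).trace := by
  have hcomp : a.charpolyRev.comp (-X) = det (1 + (X : R[X]) • a.map C) := by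
    rw [charpolyRev, ← coe_compRingHom_apply, RingHom.map_det]
    congr 1
    ext i j : 2
    by_cases h : i = j <;> simp [h]
  have hprod : a.charpolyRev * a.charpolyRev.comp (-X) =
      det (1 + (X ^ 2 : R[X]) • -(a * a).map C) := by
    rw [hcomp, charpolyRev, ← det_mul, Matrix.map_mul]
    congr 1
    simp only [sub_mul, mul_add, one_mul, mul_one, Matrix.smul_mul, Matrix.mul_smul, smul_smul,
      smul_neg]
    rw [← pow_two]; abel
  rw [det_one_add_smul] at hprod
  have h := congrArg (fun q ↦ q.coeff 2) hprod
  have hc (k : ℕ) : (a.charpolyRev.comp (-X)).coeff k = a.charpolyRev.coeff k * (-1) ^ k := by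
    rw [show (-X : R[X]) = C (-1) * X by simp, comp_C_mul_X_coeff]
  have h0 : a.charpolyRev.coeff 0 = 1 := by rw [coeff_zero_eq_eval_zero, eval_charpolyRev]
  have htr : (-(a * a).map (C : R →+* R[X])).trace = C (-(a * a).trace) := by
    rw [trace_neg, trace, trace, C_neg, map_sum]
    rfl
  rw [htr] at h
  simp [coeff_mul, hc, Finset.Nat.antidiagonal_succ, h0, ← pow_mul,
    coeff_one] at h
  linear_combination h

theorem eq_of_sq_eq_sq_of_monic {R : Type*} [CommRing R] [IsDomain R] {p q : R[X]}
    (hp : p.Monic) (hq : q.Monic) (h : p ^ 2 = q ^ 2) : p = q := by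
  rcases sq_eq_sq_iff_eq_or_eq_neg.mp h with h | h
  · exact h
  · have : (1 : R) = -1 :=
      hp.leadingCoeff.symm.trans (by rw [h, leadingCoeff_neg, hq.leadingCoeff])
    have h' : (-1 : R[X]) = 1 := by rw [← C_1, ← C_neg]; exact congrArg C this.symm
    rw [h, ← neg_one_mul, h', one_mul]

/-- Over an integrally closed domain of characteristic not two, the characteristic polynomial of
`a` is the square of a monic polynomial as soon as `J * a` is skew-symmetric for some
skew-symmetric `J` of square `-1`. -/
theorem exists_monic_sq_eq_charpoly {R : Type*} [CommRing R] [IsDomain R]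
    [UniqueFactorizationMonoid R] (h2 : (2 : R) ≠ 0) {n : Type*} [Fintype n] [DecidableEq n]
    (J a : Matrix n n R) (hJ : Jᵀ = -J) (hJ' : J * J = -1) (ha : (J * a)ᵀ = -(J * a)) :
    ∃ p : R[X], p.Monic ∧ p ^ 2 = a.charpoly := by
  let K := FractionRing R[X]
  have hinj : Function.Injective (algebraMap R[X] K) := IsFractionRing.injective _ _
  have h2X : (2 : K) ≠ 0 := by
    have : algebraMap R[X] K (C 2) = 2 := by rw [C_ofNat, map_ofNat]
    rw [← this]
    exact fun h ↦ h2 (C_injective (hinj (by rw [h, C_0, map_zero])))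
  have hdet (B : Matrix n n R[X]) (hB : Bᵀ = -B) : IsSquare (algebraMap R[X] K B.det) := by
    rw [RingHom.map_det]
    apply isSquare_det_of_transpose_eq_neg h2X
    ext i j
    have h : B j i = -B i j := congrFun (congrFun hB i) j
    simp [h]
  have hJC : (J.map (C : R →+* R[X]))ᵀ = -J.map C := by
    rw [← Matrix.transpose_map, hJ]; ext; simp
  obtain ⟨s, hs⟩ := hdet _ hJC
  obtain ⟨t, ht⟩ := hdet (J.map C * a.charmatrix) (by
    rw [charmatrix, mul_sub, RingHom.mapMatrix_apply, ← Matrix.map_mul, transpose_sub,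
      ← Matrix.transpose_map, ha, scalar_apply, transpose_mul, hJC, diagonal_transpose]
    ext i j
    simp [-Matrix.map_mul]
    ring)
  have hs0 : s ≠ 0 := by
    rintro rfl
    have h1 := congrArg det hJ'
    rw [det_mul] at h1
    have : J.det = 0 := by
      apply C_injective
      apply hinj
      rw [RingHom.map_det, RingHom.mapMatrix_apply, hs]
      simp
    rw [this, det_neg, det_one, mul_zero, mul_one] at h1
    exact pow_ne_zero _ (neg_ne_zero.mpr one_ne_zero) h1.symm
  have hsq : (t / s) ^ 2 = algebraMap R[X] K a.charpoly := by
    rw [div_pow, div_eq_iff (pow_ne_zero 2 hs0), charpoly, pow_two, pow_two, ← ht, ← hs, det_mul,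
      map_mul, mul_comm]
  obtain ⟨p, hp⟩ := IsIntegrallyClosed.exists_algebraMap_eq_of_isIntegral_pow (R := R[X])
    (x := t / s) two_pos (hsq ▸ isIntegral_algebraMap)
  have hp2 : p ^ 2 = a.charpoly := hinj (by rw [map_pow, hp, hsq])
  have hlc : p.leadingCoeff ^ 2 = 1 := by
    rw [← leadingCoeff_pow, hp2, a.charpoly_monic.leadingCoeff]
  rcases mul_self_eq_one_iff.mp ((pow_two _).symm.trans hlc) with h | h
  · exact ⟨p, h, hp2⟩
  · exact ⟨-p, by rw [Monic, leadingCoeff_neg, h, neg_neg], by rw [neg_sq, hp2]⟩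

/-- A monic square root of the characteristic polynomial of a matrix `a` of trace `2 * t` has
`4 * coeff (m - 2) = 2 * t ^ 2 - tr (a ^ 2)`. -/
theorem four_mul_coeff_of_sq_eq_charpoly {R : Type*} [CommRing R] [IsDomain R] (h2 : (2 : R) ≠ 0)
    {n : Type*} [Fintype n] [DecidableEq n] {m : ℕ} (hm : 2 ≤ m) {a : Matrix n n R} {t : R}
    (ht : a.trace = 2 * t) {p : R[X]} (hp : p.Monic) (hdeg : p.natDegree = m)
    (hsq : p ^ 2 = a.charpoly) :
    4 * p.coeff (m - 2) = 2 * t ^ 2 - (a * a).trace := by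
  have hrev : p.reverse * p.reverse = a.charpolyRev := by
    rw [← reverse_mul_of_domain, ← pow_two, hsq, reverse_charpoly]
  have h0 : p.reverse.coeff 0 = 1 := by rw [coeff_zero_reverse, hp.leadingCoeff]
  have hc2 : p.reverse.coeff 2 = p.coeff (m - 2) := by
    rw [coeff_reverse, hdeg, revAt_le hm]
  have e1 : p.reverse.coeff 1 = -t := by
    apply mul_left_cancel₀ h2
    have := a.coeff_charpolyRev_eq_neg_trace
    rw [← hrev, ht] at this
    simp only [coeff_mul, Finset.Nat.antidiagonal_succ, Finset.Nat.antidiagonal_zero, h0,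
      Finset.sum_cons, Finset.map_singleton, Finset.sum_singleton] at this
    simp only [Function.Embedding.prodMap, Function.Embedding.coeFn_mk, Prod.map,
      Nat.succ_eq_add_one, Function.Embedding.refl_apply, zero_add, h0] at this
    linear_combination this
  have e2 := two_mul_coeff_two_charpolyRev a
  rw [← hrev, ht] at e2
  simp [coeff_mul, Finset.Nat.antidiagonal_succ, h0, e1, hc2] at e2
  linear_combination e2

section SymplecticTrace

variable {R : Type*} [CommRing R] {n : Type*} [Fintype n] [DecidableEq n] {J : Matrix n n R}

theorem transpose_mul_symplectic_trace (hJ : Jᵀ = -J) (hJ' : J * J = -1) (x : Matrix n n R) :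
    (J * (x - J * xᵀ * J))ᵀ = -(J * (x - J * xᵀ * J)) := by
  have h : J * (x - J * xᵀ * J) = J * x + xᵀ * J := by
    rw [mul_sub, ← mul_assoc, ← mul_assoc, hJ']
    simp
  rw [h, transpose_add, transpose_mul, transpose_mul, hJ, transpose_transpose]
  simp [add_comm]

theorem trace_symplectic_trace (hJ' : J * J = -1) (x : Matrix n n R) :
    (x - J * xᵀ * J).trace = 2 * x.trace := by
  rw [trace_sub, trace_mul_cycle, hJ', neg_one_mul, trace_neg, trace_transpose]
  ring

theorem trace_mul_symplectic_trace (hJ : Jᵀ = -J) (hJ' : J * J = -1) (a y : Matrix n n R)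
    (ha : (J * a)ᵀ = -(J * a)) :
    (a * (y - J * yᵀ * J)).trace = 2 * (a * y).trace := by
  have h : aᵀ * J = J * a := by
    rw [transpose_mul, hJ, mul_neg, neg_inj] at ha
    exact ha
  have h' : (a * (J * yᵀ * J)).trace = -(a * y).trace := by
    rw [← mul_assoc, trace_mul_comm, ← mul_assoc, ← mul_assoc, ← h, mul_assoc aᵀ, hJ', mul_neg_one,
      neg_mul, trace_neg, ← transpose_mul, trace_transpose, trace_mul_comm]
  rw [mul_sub, trace_sub, h']
  ring

/-- The polar identity for monic square roots of characteristic polynomials over a domain of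
characteristic not two. -/
theorem polar_coeff_of_sq_eq_charpoly [IsDomain R] (h2 : (2 : R) ≠ 0) {m : ℕ} (hm : 2 ≤ m)
    (hJ : Jᵀ = -J) (hJ' : J * J = -1) (x y : Matrix n n R) {p q r : R[X]}
    (hp : p.Monic) (hpd : p.natDegree = m) (hps : p ^ 2 = (x - J * xᵀ * J).charpoly)
    (hq : q.Monic) (hqd : q.natDegree = m) (hqs : q ^ 2 = (y - J * yᵀ * J).charpoly)
    (hr : r.Monic) (hrd : r.natDegree = m)
    (hrs : r ^ 2 = ((x - J * xᵀ * J) + (y - J * yᵀ * J)).charpoly) :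
    r.coeff (m - 2) - p.coeff (m - 2) - q.coeff (m - 2) =
      x.trace * y.trace - ((x - J * xᵀ * J) * y).trace := by
  have tx := trace_symplectic_trace hJ' x
  have ty := trace_symplectic_trace hJ' y
  have hab := trace_mul_symplectic_trace hJ hJ' _ y (transpose_mul_symplectic_trace hJ hJ' x)
  set a := x - J * xᵀ * J
  set b := y - J * yᵀ * J
  have txy : (a + b).trace = 2 * (x.trace + y.trace) := by rw [trace_add, tx, ty]; ring
  have cp := four_mul_coeff_of_sq_eq_charpoly h2 hm tx hp hpd hps
  have cq := four_mul_coeff_of_sq_eq_charpoly h2 hm ty hq hqd hqs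
  have cr := four_mul_coeff_of_sq_eq_charpoly h2 hm txy hr hrd hrs
  have hexp : ((a + b) * (a + b)).trace =
      (a * a).trace + (b * b).trace + 2 * (a * b).trace := by
    rw [add_mul, mul_add, mul_add, trace_add, trace_add, trace_add, trace_mul_comm b a]
    ring
  apply mul_left_cancel₀ h2
  apply mul_left_cancel₀ h2
  linear_combination cr - cp - cq - hexp - 2 * hab

/-- The polar identity for monic square roots of characteristic polynomials after a change of
rings from a factorial domain of characteristic not two. -/
theorem polar_coeff_of_sq_eq_charpoly_map [IsDomain R] [UniqueFactorizationMonoid R]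
    (h2 : (2 : R) ≠ 0) {F : Type*} [Field F] (φ : R →+* F) {m : ℕ} (hm : 2 ≤ m)
    (hn : Fintype.card n = 2 * m) (hJ : Jᵀ = -J) (hJ' : J * J = -1) (x y : Matrix n n R)
    {p q r : F[X]}
    (hp : p.Monic) (hps : p ^ 2 = (φ.mapMatrix (x - J * xᵀ * J)).charpoly)
    (hq : q.Monic) (hqs : q ^ 2 = (φ.mapMatrix (y - J * yᵀ * J)).charpoly)
    (hr : r.Monic)
    (hrs : r ^ 2 = (φ.mapMatrix ((x - J * xᵀ * J) + (y - J * yᵀ * J))).charpoly) :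
    r.coeff (m - 2) - p.coeff (m - 2) - q.coeff (m - 2) =
      φ (x.trace * y.trace - ((x - J * xᵀ * J) * y).trace) := by
  have hroot (a : Matrix n n R) (ha : (J * a)ᵀ = -(J * a)) (p : F[X])
      (hp : p.Monic) (hsq : p ^ 2 = (φ.mapMatrix a).charpoly) :
      ∃ P : R[X], P.Monic ∧ P.natDegree = m ∧ P ^ 2 = a.charpoly ∧ P.map φ = p := by
    obtain ⟨P, hP, hP2⟩ := exists_monic_sq_eq_charpoly h2 J a hJ hJ' ha
    refine ⟨P, hP, ?_, hP2, eq_of_sq_eq_sq_of_monic (hP.map φ) hp ?_⟩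
    · have := congrArg natDegree hP2
      rw [hP.natDegree_pow, charpoly_natDegree_eq_dim, hn] at this
      omega
    · rw [hsq, RingHom.mapMatrix_apply, charpoly_map, ← hP2, Polynomial.map_pow]
  have hx := transpose_mul_symplectic_trace hJ hJ' x
  have hy := transpose_mul_symplectic_trace hJ hJ' y
  have hxy : (J * ((x - J * xᵀ * J) + (y - J * yᵀ * J)))ᵀ =
      -(J * ((x - J * xᵀ * J) + (y - J * yᵀ * J))) := by
    rw [mul_add, transpose_add, hx, hy, neg_add]
  obtain ⟨A, hA, hAd, hAs, rfl⟩ := hroot _ hx p hp hps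
  obtain ⟨B, hB, hBd, hBs, rfl⟩ := hroot _ hy q hq hqs
  obtain ⟨D, hD, hDd, hDs, rfl⟩ := hroot _ hxy r hr hrs
  rw [← polar_coeff_of_sq_eq_charpoly h2 hm hJ hJ' x y hA hAd hAs hB hBd hBs hD hDd hDs]
  simp only [map_sub, coeff_map]

end SymplecticTrace

/-- The matrix `sympJ` over an arbitrary ring. -/
def symplecticMatrix (R : Type*) [Ring R] (m : ℕ) : Matrix (Fin (2 * m)) (Fin (2 * m)) R :=
  Matrix.of fun i j =>
    if i.val % 2 = 0 ∧ j.val = i.val + 1 then (1 : R)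
    else if i.val % 2 = 1 ∧ i.val = j.val + 1 then (-1 : R)
    else 0

theorem symplecticMatrix_transpose (R : Type*) [Ring R] (m : ℕ) :
    (symplecticMatrix R m)ᵀ = -symplecticMatrix R m := by
  ext i j
  simp only [symplecticMatrix, transpose_apply, Matrix.neg_apply, of_apply]
  split_ifs <;> first | omega | simp

theorem symplecticMatrix_mul_self (R : Type*) [Ring R] (m : ℕ) :
    symplecticMatrix R m * symplecticMatrix R m = -1 := by
  ext i j
  rw [mul_apply]
  obtain ⟨k, hk⟩ : ∃ k : Fin (2 * m),
      (i.val % 2 = 0 ∧ k.val = i.val + 1) ∨ (i.val % 2 = 1 ∧ i.val = k.val + 1) := by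
    rcases Nat.mod_two_eq_zero_or_one i.val with h | h
    · exact ⟨⟨i.val + 1, by omega⟩, Or.inl ⟨h, rfl⟩⟩
    · exact ⟨⟨i.val - 1, by omega⟩, Or.inr ⟨h, by simp; omega⟩⟩
  rw [Finset.sum_eq_single k]
  · simp only [symplecticMatrix, Matrix.neg_apply, of_apply, Matrix.one_apply, Fin.ext_iff]
    split_ifs <;> first | omega | simp
  · intro l _ hl
    have hl' : l.val ≠ k.val := fun h ↦ hl (Fin.ext h)
    simp only [symplecticMatrix, of_apply]
    rw [if_neg (by omega), if_neg (by omega), zero_mul]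
  · simp

theorem symplecticMatrix_map {R S : Type*} [Ring R] [Ring S] (f : R →+* S) (m : ℕ) :
    (symplecticMatrix R m).map f = symplecticMatrix S m := by
  ext i j
  simp only [symplecticMatrix, map_apply, of_apply]
  split_ifs <;> simp

theorem sympInv_eq (F : Type*) [Field F] (m : ℕ) (x : Matrix (Fin (2 * m)) (Fin (2 * m)) F) :
    x + sympInv F m x = x - symplecticMatrix F m * xᵀ * symplecticMatrix F m := by
  have hJ : sympJ F m = symplecticMatrix F m := rfl
  have hinv : (symplecticMatrix F m)⁻¹ = -symplecticMatrix F m :=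
    inv_eq_right_inv (by rw [mul_neg, symplecticMatrix_mul_self, neg_neg])
  rw [sympInv, hJ, hinv, neg_mul, neg_mul, sub_eq_add_neg]

/-- Polar identity for the quadratic map `Srp` in the split case: with `a = x + σ(x)`,
`b = y + σ(y)`, and `pa`, `pb`, `pab` the reduced Pfaffian polynomials of `a`, `b`
and `a + b`, one has
`Srp(a+b) - Srp(a) - Srp(b) = trace(x)·trace(y) - trace(a·y)`,
where `Srp` is the coefficient of `X^(m-2)`. -/
theorem stmt2 (F : Type*) [Field F] (m : ℕ) (hm : 2 ≤ m)
    (x y : Matrix (Fin (2 * m)) (Fin (2 * m)) F) (pa pb pab : F[X])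
    (hamonic : pa.Monic) (hadeg : pa.natDegree = m)
    (hasq : pa ^ 2 = (x + sympInv F m x).charpoly)
    (hbmonic : pb.Monic) (hbdeg : pb.natDegree = m)
    (hbsq : pb ^ 2 = (y + sympInv F m y).charpoly)
    (habmonic : pab.Monic) (habdeg : pab.natDegree = m)
    (habsq : pab ^ 2 = ((x + sympInv F m x) + (y + sympInv F m y)).charpoly) :
    pab.coeff (m - 2) - pa.coeff (m - 2) - pb.coeff (m - 2)
      = x.trace * y.trace - ((x + sympInv F m x) * y).trace := by
  let φ : MvPolynomial F ℤ →+* F := MvPolynomial.eval₂Hom (Int.castRingHom F) id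
  let J := symplecticMatrix (MvPolynomial F ℤ) m
  let gen (z : Matrix (Fin (2 * m)) (Fin (2 * m)) F) :
      Matrix (Fin (2 * m)) (Fin (2 * m)) (MvPolynomial F ℤ) := z.map MvPolynomial.X
  have hgen (z) : φ.mapMatrix (gen z) = z := by
    ext i j
    exact MvPolynomial.eval₂_X _ _ _
  have hgenσ (z) : φ.mapMatrix (gen z - J * (gen z)ᵀ * J) = z + sympInv F m z := by
    have hmapJ : φ.mapMatrix J = symplecticMatrix F m := symplecticMatrix_map φ m
    have hT : φ.mapMatrix (gen z)ᵀ = zᵀ := congrArg transpose (hgen z)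
    rw [map_sub, map_mul, map_mul, hgen, hT, hmapJ, sympInv_eq]
  have htr (z : Matrix (Fin (2 * m)) (Fin (2 * m)) (MvPolynomial F ℤ)) :
      φ z.trace = (φ.mapMatrix z).trace := AddMonoidHom.map_trace φ z
  have hsum : φ.mapMatrix ((gen x - J * (gen x)ᵀ * J) + (gen y - J * (gen y)ᵀ * J)) =
      (x + sympInv F m x) + (y + sympInv F m y) := by
    rw [map_add, hgenσ, hgenσ]
  rw [polar_coeff_of_sq_eq_charpoly_map two_ne_zero φ hm (Fintype.card_fin _)
    (symplecticMatrix_transpose _ m) (symplecticMatrix_mul_self _ m) (gen x) (gen y)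
    hamonic (hasq.trans (congrArg charpoly (hgenσ x).symm))
    hbmonic (hbsq.trans (congrArg charpoly (hgenσ y).symm))
    habmonic (habsq.trans (congrArg charpoly hsum.symm))]
  rw [map_sub, map_mul, htr, htr, htr, map_mul, hgen, hgen, hgenσ]
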